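/- Let (X, B, μ) be a probability space and U an invertible ergodic measure-preserving transformation. If for some 1 < p < ∞ the maximal ergodic operator M̃ is bounded on L^p_w(X), i.e., ‖M̃f‖_{L^p_w(X)} ≤ C ‖f‖_{L^p_w(X)} for all f ∈ L^p_w(X), then w is an ergodic A_p weight on X. -/

import Mathlib

open scoped ENNReal BigOperators
open MeasureTheory

/-- The maximal ergodic operator associated with an invertible transformation `U`. -/
noncomputable def MErg {X : Type*} (U : Equiv.Perm X) (f : X → ℝ) (x : X) : ℝ≥0∞ :=
  ⨆ (J : ℕ) (_ : 1 ≤ J),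
    (∑ k ∈ Finset.Icc (-(J : ℤ)) (J : ℤ), ENNReal.ofReal |f ((U ^ (-k)) x)|) /
      ((2 * J + 1 : ℕ) : ℝ≥0∞)

/-- The ergodic `A_p` condition (for `1 < p < ∞`) with constant `C`. -/
def ErgodicAp {X : Type*} [MeasurableSpace X] (μ : Measure X) (U : Equiv.Perm X)
    (w : X → ℝ) (p C : ℝ) : Prop :=
  ∀ᵐ x ∂μ, ∀ N : ℕ, 1 ≤ N →
    ((∑ k ∈ Finset.Icc (-(N : ℤ)) (N : ℤ), w ((U ^ k) x)) / (2 * N + 1 : ℝ)) *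
      (((∑ k ∈ Finset.Icc (-(N : ℤ)) (N : ℤ), w ((U ^ k) x) ^ (-(1 : ℝ) / (p - 1))) /
        (2 * N + 1 : ℝ)) ^ (p - 1)) ≤ C

namespace ErgAp

variable {X : Type*} [MeasurableSpace X] {μ : Measure X}

theorem mp (U : Equiv.Perm X) (hU : MeasurePreserving U μ μ)
    (hUsymm : MeasurePreserving U.symm μ μ) (k : ℤ) : MeasurePreserving (⇑(U ^ k)) μ μ := by
  cases k with
  | ofNat n =>
    have := hU.iterate n
    rw [Equiv.Perm.iterate_eq_pow] at this
    simpa using this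
  | negSucc n =>
    have := hUsymm.iterate (n+1)
    rw [show (⇑U.symm) = ⇑(U⁻¹) from rfl, Equiv.Perm.iterate_eq_pow] at this
    rw [zpow_negSucc, ← inv_pow]
    exact this

theorem comp (U : Equiv.Perm X) (j k : ℤ) (x : X) : (U ^ j) ((U ^ k) x) = (U ^ (j + k)) x := by
  rw [zpow_add, Equiv.Perm.mul_apply]

/-- sub-lemma on sparse subsets -/
theorem sparse [IsProbabilityMeasure μ] (U : Equiv.Perm X) (hErg : Ergodic U μ)
    (hU : MeasurePreserving U μ μ) (hUsymm : MeasurePreserving U.symm μ μ)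
    (n : ℕ) (hn : 1 ≤ n) (B : Set X) (hB : MeasurableSet B) (h0 : μ B ≠ 0)
    (h1 : n * μ B < 1) :
    ∃ E ⊆ B, MeasurableSet E ∧ μ E ≠ 0 ∧ ∀ x ∈ E, ∀ j ∈ Finset.Icc (1:ℤ) n, (U ^ j) x ∉ E := by
  have hm : ∀ k : ℤ, Measurable (⇑(U ^ k)) := fun k => (mp U hU hUsymm k).measurable
  set D : Set X := ⋃ j ∈ Finset.Icc (1:ℤ) n, (U ^ j) ⁻¹' B with hD
  have hDm : MeasurableSet D := by
    refine Finset.measurableSet_biUnion _ fun j _ => hm j hB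
  refine ⟨B \ D, Set.sdiff_subset, hB.diff hDm, ?_, ?_⟩
  · intro hE
    have hsub : D ≤ᵐ[μ] U ⁻¹' D := by
      have : ∀ᵐ x ∂μ, U x ∉ B \ D := by
        refine hU.quasiMeasurePreserving.ae (p := fun x => x ∉ B \ D) ?_
        rw [ae_iff]; simp only [not_not]; exact hE
      filter_upwards [this] with x hx
      intro hxD
      change x ∈ D at hxD
      change U x ∈ D
      simp only [hD, Set.mem_iUnion, Set.mem_preimage, Finset.mem_Icc] at hxD
      obtain ⟨j, hj, hxj⟩ := hxD
      by_cases hj1 : j = 1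
      · subst hj1
        by_contra hc
        exact hx ⟨by simpa using hxj, hc⟩
      · simp only [hD, Set.mem_iUnion, Set.mem_preimage, Finset.mem_Icc]
        refine ⟨j - 1, ⟨by omega, by omega⟩, ?_⟩
        have := comp U (j-1) 1 x
        simp only [zpow_one, sub_add_cancel] at this
        rw [this]; exact hxj
    have hle : μ D ≤ n * μ B := by
      refine (measure_biUnion_finset_le _ _).trans ?_
      rw [Finset.sum_congr rfl fun j _ => (mp U hU hUsymm j).measure_preimage hB.nullMeasurableSet]
      simp
    have hge : μ B ≤ μ D := by
      rw [← (mp U hU hUsymm 1).measure_preimage hB.nullMeasurableSet]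
      refine measure_mono ?_
      refine Set.subset_biUnion_of_mem (u := fun j : ℤ => (U ^ j) ⁻¹' B) ?_
      simp; omega
    rcases hErg.ae_empty_or_univ_of_ae_le_preimage hDm.nullMeasurableSet hsub with h | h
    · rw [measure_congr h] at hge
      simp at hge; exact h0 hge
    · rw [measure_congr h] at hle
      simp at hle; exact absurd h1 (not_lt.mpr hle)
  · intro x hx j hj hxj
    apply hx.2
    simp only [hD, Set.mem_iUnion, Set.mem_preimage]
    exact ⟨j, hj, hxj.1⟩

/-- dichotomy -/
theorem small [IsProbabilityMeasure μ] (U : Equiv.Perm X) (hErg : Ergodic U μ)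
    (hU : MeasurePreserving U μ μ) (hUsymm : MeasurePreserving U.symm μ μ)
    (G : ℕ → Set X) (hG : ∀ M, MeasurableSet (G M)) (hmono : Monotone G)
    (hun : ⋃ M, G M = Set.univ)
    (hnot : ¬ ∃ M, ∀ᵐ x ∂μ, ∀ k : ℤ, (U ^ k) x ∈ G M)
    (B : Set X) (hB : MeasurableSet B) (h0 : μ B ≠ 0) (ε : ℝ≥0∞) (hε : ε ≠ 0) :
    ∃ B' ⊆ B, MeasurableSet B' ∧ μ B' ≠ 0 ∧ μ B' < ε := by
  have hm : ∀ k : ℤ, Measurable (⇑(U ^ k)) := fun k => (mp U hU hUsymm k).measurable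
  by_contra hc
  push Not at hc
  apply hnot
  have hlim : Filter.Tendsto (fun M => μ (G M)ᶜ) Filter.atTop (nhds 0) := by
    have := tendsto_measure_iInter_atTop (μ := μ) (s := fun M => (G M)ᶜ)
      (fun M => (hG M).compl.nullMeasurableSet) (fun a b h => Set.compl_subset_compl.mpr (hmono h))
      ⟨0, measure_ne_top _ _⟩
    rw [← Set.compl_iUnion, hun] at this
    simpa [Function.comp_def] using this
  obtain ⟨M, hM⟩ := (hlim.eventually (gt_mem_nhds (pos_iff_ne_zero.mpr hε))).exists
  refine ⟨M, ?_⟩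
  set H : Set X := ⋂ k : ℤ, (U ^ k) ⁻¹' G M with hH
  have hHm : MeasurableSet H := MeasurableSet.iInter fun k => hm k (hG M)
  have hBH : μ (B \ H) = 0 := by
    have : B \ H = ⋃ k : ℤ, B ∩ (U ^ k) ⁻¹' (G M)ᶜ := by
      ext x; simp [hH]
    rw [this, measure_iUnion_null_iff]
    intro k
    by_contra hne
    have h2 := hc _ Set.inter_subset_left (hB.inter (hm k (hG M).compl)) hne
    have h3 : μ (B ∩ (U ^ k) ⁻¹' (G M)ᶜ) ≤ μ (G M)ᶜ := by
      rw [← (mp U hU hUsymm k).measure_preimage (hG M).compl.nullMeasurableSet]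
      exact measure_mono Set.inter_subset_right
    exact absurd (h2.trans h3) (not_le.mpr hM)
  have hsub : H ≤ᵐ[μ] U ⁻¹' H := by
    refine Filter.Eventually.of_forall fun x hx => ?_
    change x ∈ H at hx
    change U x ∈ H
    simp only [hH, Set.mem_iInter, Set.mem_preimage] at hx ⊢
    intro k
    have := comp U k 1 x
    simp only [zpow_one] at this
    rw [this]; exact hx _
  rcases hErg.ae_empty_or_univ_of_ae_le_preimage hHm.nullMeasurableSet hsub with h | h
  · exfalso
    apply h0
    have h4 : μ H = 0 := by rw [measure_congr h]; simp
    have := measure_mono (μ := μ) (s := B) (t := (B \ H) ∪ H) (by intro x hx; by_cases h : x ∈ H <;> simp [h, hx])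
    exact le_antisymm (this.trans ((measure_union_le _ _).trans (by simp [hBH, h4]))) bot_le
  · filter_upwards [h] with x hx
    have : x ∈ H := (iff_of_eq hx).mpr trivial
    simpa [hH] using this

/-- main integral estimate -/
theorem est [IsProbabilityMeasure μ] (U : Equiv.Perm X)
    (hU : MeasurePreserving U μ μ) (hUsymm : MeasurePreserving U.symm μ μ)
    (w : X → ℝ) (hw : ∀ x, 0 ≤ w x) (hwm : Measurable w)
    (p : ℝ) (hp : 1 < p) (C : ℝ≥0∞)
    (hbound : ∀ f : X → ℝ, Measurable f →
      (∫⁻ x, ENNReal.ofReal |f x| ^ p * ENNReal.ofReal (w x) ∂μ) ≠ ∞ →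
      (∫⁻ x, (MErg U f x) ^ p * ENNReal.ofReal (w x) ∂μ) ^ (1 / p) ≤
        C * (∫⁻ x, ENNReal.ofReal |f x| ^ p * ENNReal.ofReal (w x) ∂μ) ^ (1 / p))
    (N : ℕ) (hN : 1 ≤ N) (E : Set X) (hE : MeasurableSet E)
    (hdis : ∀ x ∈ E, ∀ j ∈ Finset.Icc (1:ℤ) (2 * N : ℕ), (U ^ j) x ∉ E)
    (s : X → ℝ≥0∞) (hs : s = fun x => ∑ k ∈ Finset.Icc (-(N : ℤ)) (N : ℤ),
      ENNReal.ofReal (w ((U ^ k) x) ^ (-(1 : ℝ) / (p - 1))))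
    (v : X → ℝ≥0∞) (hv : v = fun x => ∑ k ∈ Finset.Icc (-(N : ℤ)) (N : ℤ),
      ENNReal.ofReal (w ((U ^ k) x)))
    (hfin : ∫⁻ x in E, s x ∂μ ≠ ∞) :
    ∫⁻ x in E, (s x / ((4 * N + 1 : ℕ) : ℝ≥0∞)) ^ p * v x ∂μ ≤ C ^ p * ∫⁻ x in E, s x ∂μ := by
  classical
  have hmp := mp U hU hUsymm
  have hm : ∀ k : ℤ, Measurable (⇑(U ^ k)) := fun k => (hmp k).measurable
  have hp0 : 0 < p := by linarith
  set I := Finset.Icc (-(N : ℤ)) (N : ℤ) with hI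
  set σ : X → ℝ := fun x => w x ^ (-(1 : ℝ) / (p - 1)) with hσ
  have hσ0 : ∀ x, 0 ≤ σ x := fun x => Real.rpow_nonneg (hw x) _
  have hσm : Measurable σ := hwm.pow_const _
  have hσw : ∀ x, ENNReal.ofReal (σ x) ^ p * ENNReal.ofReal (w x) = ENNReal.ofReal (σ x) := by
    intro x
    rw [ENNReal.ofReal_rpow_of_nonneg (hσ0 x) hp0.le, ← ENNReal.ofReal_mul (Real.rpow_nonneg (hσ0 x) _)]
    congr 1
    have hp1 : p - 1 ≠ 0 := by linarith
    rcases (hw x).eq_or_lt with h | h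
    · simp only [hσ, ← h, mul_zero]
      rw [Real.zero_rpow]
      exact div_ne_zero (by norm_num) hp1
    · simp only [hσ]
      rw [← Real.rpow_mul h.le]
      nth_rewrite 2 [← Real.rpow_one (w x)]
      rw [← Real.rpow_add h]
      congr 1
      field_simp
      ring
  have hsm : Measurable s := by
    rw [hs]
    exact Finset.measurable_sum _ fun k _ => (hσm.comp (hm k)).ennreal_ofReal
  set D : Set X := ⋃ j ∈ I, (U ^ (-j)) ⁻¹' E with hD
  have hDm : MeasurableSet D := Finset.measurableSet_biUnion _ fun j _ => hm _ hE
  set f : X → ℝ := D.indicator σ with hf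
  have hfm : Measurable f := hσm.indicator hDm
  -- change of variables
  have key : ∀ (a : X → ℝ≥0∞) (g : X → ℝ≥0∞), Measurable a → Measurable g →
      ∫⁻ y, ∑ j ∈ I, E.indicator a ((U ^ (-j)) y) * g y ∂μ
        = ∫⁻ x in E, a x * ∑ j ∈ I, g ((U ^ j) x) ∂μ := by
    intro a g ha hg
    have hai := ha.indicator hE
    have hterm : ∀ j : ℤ, Measurable fun y => E.indicator a ((U ^ (-j)) y) * g y :=
      fun j => (hai.comp (hm _)).mul hg
    have hterm' : ∀ j : ℤ, Measurable fun x => E.indicator a x * g ((U ^ j) x) :=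
      fun j => hai.mul (hg.comp (hm _))
    rw [lintegral_finsetSum _ fun j _ => hterm j]
    have : ∀ j ∈ I, ∫⁻ y, E.indicator a ((U ^ (-j)) y) * g y ∂μ
        = ∫⁻ x, E.indicator a x * g ((U ^ j) x) ∂μ := by
      intro j _
      rw [← (hmp j).lintegral_comp (hterm j)]
      refine lintegral_congr fun x => ?_
      rw [comp, neg_add_cancel]; simp
    rw [Finset.sum_congr rfl this, ← lintegral_finsetSum _ fun j _ => hterm' j,
      ← lintegral_indicator hE]
    refine lintegral_congr fun x => ?_
    by_cases hx : x ∈ E <;> simp [hx, Finset.mul_sum]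
  have hup : ∫⁻ x, ENNReal.ofReal |f x| ^ p * ENNReal.ofReal (w x) ∂μ ≤ ∫⁻ x in E, s x ∂μ := by
    have h1 := key (fun _ => 1) (fun x => ENNReal.ofReal (σ x)) measurable_const hσm.ennreal_ofReal
    simp only [one_mul] at h1
    rw [hs, ← h1]
    refine lintegral_mono fun y => ?_
    by_cases hy : y ∈ D
    · simp only [hf, Set.indicator_of_mem hy, abs_of_nonneg (hσ0 y), hσw]
      simp only [hD, Set.mem_iUnion, Set.mem_preimage] at hy
      obtain ⟨j, hj, hyj⟩ := hy
      refine le_trans ?_ (Finset.single_le_sum (f := fun j : ℤ => E.indicator (fun _ => (1:ℝ≥0∞)) ((U ^ (-j)) y) * ENNReal.ofReal (σ y)) (fun _ _ => bot_le) hj)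
      rw [Set.indicator_of_mem hyj, one_mul]
    · simp [hf, Set.indicator_of_notMem hy, hp0]
  have hlow : ∫⁻ x in E, (s x / ((4 * N + 1 : ℕ) : ℝ≥0∞)) ^ p * v x ∂μ
      ≤ ∫⁻ x, (MErg U f x) ^ p * ENNReal.ofReal (w x) ∂μ := by
    have h1 := key (fun x => (s x / ((4 * N + 1 : ℕ) : ℝ≥0∞)) ^ p) (fun x => ENNReal.ofReal (w x))
      ((hsm.div_const _).pow_const _) hwm.ennreal_ofReal
    rw [hv, ← h1]
    refine lintegral_mono fun y => ?_
    change _ ≤ MErg U f y ^ p * ENNReal.ofReal (w y)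
    rw [← Finset.sum_mul]
    gcongr
    by_cases hy : ∃ j ∈ I, (U ^ (-j)) y ∈ E
    · obtain ⟨j, hj, hyj⟩ := hy
      rw [Finset.sum_eq_single_of_mem j hj]
      · rw [Set.indicator_of_mem hyj]
        gcongr
        refine le_trans ?_ (le_iSup₂_of_le (2 * N) (by omega) le_rfl)
        rw [show 2 * (2 * N) + 1 = 4 * N + 1 by ring]
        gcongr
        rw [hs]
        have hinj : Set.InjOn (fun k : ℤ => j - k) I := by intro a _ b _ h; simpa using h
        have : ∀ k ∈ I, ENNReal.ofReal (w ((U ^ k) ((U ^ (-j)) y)) ^ (-(1 : ℝ) / (p - 1)))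
            = ENNReal.ofReal |f ((U ^ (-(j - k))) y)| := by
          intro k hk
          rw [comp, show -(j-k) = k + -j by ring]
          have hmem : (U ^ (k + -j)) y ∈ D := by
            simp only [hD, Set.mem_iUnion, Set.mem_preimage]
            refine ⟨k, hk, ?_⟩
            rw [comp]; simpa using hyj
          simp only [hf, Set.indicator_of_mem hmem, abs_of_nonneg (hσ0 _)]
          rfl
        change ∑ k ∈ I, _ ≤ _
        rw [Finset.sum_congr rfl this]
        rw [← Finset.sum_image (f := fun k : ℤ => ENNReal.ofReal |f ((U ^ (-k)) y)|) hinj]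
        refine Finset.sum_le_sum_of_subset ?_
        intro m hm
        simp only [Finset.mem_image, hI, Finset.mem_Icc] at hm hj ⊢
        obtain ⟨k, hk, rfl⟩ := hm
        push_cast
        omega
      · intro i hi hij
        apply Set.indicator_of_notMem
        intro hyi
        simp only [hI, Finset.mem_Icc] at hi hj
        rcases lt_or_gt_of_ne hij with h | h
        · refine hdis _ hyj (j - i) (by simp only [Finset.mem_Icc]; push_cast; omega) ?_
          rw [comp]; convert hyi using 3; ring
        · refine hdis _ hyi (i - j) (by simp only [Finset.mem_Icc]; push_cast; omega) ?_
          rw [comp]; convert hyj using 3; ring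
    · push Not at hy
      rw [Finset.sum_eq_zero fun j hj => Set.indicator_of_notMem (hy j hj) _]
      exact bot_le
  have hb := hbound f hfm (ne_top_of_le_ne_top hfin hup)
  refine hlow.trans ?_
  have h2 := ENNReal.rpow_le_rpow hb hp0.le
  rw [ENNReal.mul_rpow_of_nonneg _ _ hp0.le, ← ENNReal.rpow_mul, ← ENNReal.rpow_mul,
    one_div_mul_cancel hp0.ne', ENNReal.rpow_one, ENNReal.rpow_one] at h2
  exact h2.trans (by gcongr)

/-- measurable case -/
theorem meas [IsProbabilityMeasure μ] (U : Equiv.Perm X) (hErg : Ergodic U μ)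
    (hU : MeasurePreserving U μ μ) (hUsymm : MeasurePreserving U.symm μ μ)
    (w : X → ℝ) (hw : ∀ x, 0 ≤ w x) (hwm : Measurable w)
    (p : ℝ) (hp : 1 < p) (C : ℝ≥0∞) (hC : C ≠ ∞)
    (hbound : ∀ f : X → ℝ, Measurable f →
      (∫⁻ x, ENNReal.ofReal |f x| ^ p * ENNReal.ofReal (w x) ∂μ) ≠ ∞ →
      (∫⁻ x, (MErg U f x) ^ p * ENNReal.ofReal (w x) ∂μ) ^ (1 / p) ≤
        C * (∫⁻ x, ENNReal.ofReal |f x| ^ p * ENNReal.ofReal (w x) ∂μ) ^ (1 / p)) :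
    ∃ C' : ℝ, ErgodicAp μ U w p C' := by
  have hmp := mp U hU hUsymm
  have hm : ∀ k : ℤ, Measurable (⇑(U ^ k)) := fun k => (hmp k).measurable
  have hp0 : 0 < p := by linarith
  have hp1 : 0 < p - 1 := by linarith
  set σ : X → ℝ := fun x => w x ^ (-(1 : ℝ) / (p - 1)) with hσ
  have hσ0 : ∀ x, 0 ≤ σ x := fun x => Real.rpow_nonneg (hw x) _
  have hσm : Measurable σ := hwm.pow_const _
  let G : ℕ → Set X := fun M => {x | w x ≤ M ∧ σ x ≤ M}
  by_cases hcase : ∃ M, ∀ᵐ x ∂μ, ∀ k : ℤ, (U ^ k) x ∈ G M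
  · obtain ⟨M, hM⟩ := hcase
    refine ⟨M * (M:ℝ) ^ (p - 1), ?_⟩
    filter_upwards [hM] with x hx
    intro N hN
    have hcard : ∀ g : X → ℝ, (∀ k : ℤ, g ((U ^ k) x) ≤ M) →
        (∑ k ∈ Finset.Icc (-(N : ℤ)) (N : ℤ), g ((U ^ k) x)) / (2 * N + 1 : ℝ) ≤ M := by
      intro g hg
      rw [div_le_iff₀ (by positivity)]
      refine (Finset.sum_le_card_nsmul _ _ (M:ℝ) fun k _ => hg k).trans ?_
      rw [Int.card_Icc, nsmul_eq_mul, show ((N:ℤ) + 1 - -(N:ℤ)).toNat = 2 * N + 1 by omega]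
      push_cast
      rw [mul_comm]
    have h1 := hcard w fun k => (hx k).1
    have h2 := hcard σ fun k => (hx k).2
    have h3 : 0 ≤ (∑ k ∈ Finset.Icc (-(N : ℤ)) (N : ℤ), σ ((U ^ k) x)) / (2 * N + 1 : ℝ) :=
      div_nonneg (Finset.sum_nonneg fun k _ => hσ0 _) (by positivity)
    exact mul_le_mul h1 (Real.rpow_le_rpow h3 h2 hp1.le) (Real.rpow_nonneg h3 _) (by positivity)
  -- main case
  set c : ℝ := (C ^ p).toReal with hc
  have hCp : C ^ p = ENNReal.ofReal c := by
    rw [hc, ENNReal.ofReal_toReal (ENNReal.rpow_ne_top_of_nonneg hp0.le hC)]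
  have hc0 : 0 ≤ c := ENNReal.toReal_nonneg
  refine ⟨2 ^ p * (c + 1), ?_⟩
  unfold ErgodicAp
  rw [ae_all_iff]
  intro N
  by_cases hN : 1 ≤ N
  swap
  · exact Filter.Eventually.of_forall fun x h => absurd h hN
  let sr : X → ℝ := fun x => ∑ k ∈ Finset.Icc (-(N : ℤ)) (N : ℤ), σ ((U ^ k) x)
  let vr : X → ℝ := fun x => ∑ k ∈ Finset.Icc (-(N : ℤ)) (N : ℤ), w ((U ^ k) x)
  have hsr0 : ∀ x, 0 ≤ sr x := fun x => Finset.sum_nonneg fun k _ => hσ0 _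
  have hvr0 : ∀ x, 0 ≤ vr x := fun x => Finset.sum_nonneg fun k _ => hw _
  have hsrm : Measurable sr := Finset.measurable_sum _ fun k _ => hσm.comp (hm k)
  have hvrm : Measurable vr := Finset.measurable_sum _ fun k _ => hwm.comp (hm k)
  let bad : ℕ → Set X := fun L => {x | 2 ^ p * (c + 1) <
    (vr x / (2 * N + 1)) * (sr x / (2 * N + 1)) ^ (p - 1) ∧ sr x ≤ L}
  have hbadm : ∀ L, MeasurableSet (bad L) := fun L =>
    (measurableSet_lt measurable_const
      ((hvrm.div_const _).mul ((hsrm.div_const _).pow_const _))).inter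
      (measurableSet_le hsrm measurable_const)
  have hbad : ∀ L, μ (bad L) = 0 := by
    intro L
    by_contra hne
    obtain ⟨B, hBsub, hBm, hB0, hBs⟩ := small U hErg hU hUsymm G
      (fun M => (measurableSet_le hwm measurable_const).inter (measurableSet_le hσm measurable_const))
      (fun a b h x hx => ⟨hx.1.trans (by exact_mod_cast h), hx.2.trans (by exact_mod_cast h)⟩)
      (by
        ext x
        simp only [Set.mem_iUnion, Set.mem_univ, iff_true]
        obtain ⟨M, hM⟩ := exists_nat_ge (max (w x) (σ x))
        exact ⟨M, (le_max_left _ _).trans hM, (le_max_right _ _).trans hM⟩)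
      hcase (bad L) (hbadm L) hne (1 / ((2 * N : ℕ) : ℝ≥0∞)) (by rw [one_div]; exact ENNReal.inv_ne_zero.mpr (ENNReal.natCast_ne_top _))
    obtain ⟨E, hEB, hEm, hE0, hdis⟩ := sparse U hErg hU hUsymm (2 * N) (by omega) B hBm hB0
      (by
        rw [mul_comm]
        refine (ENNReal.lt_div_iff_mul_lt ?_ ?_).mp hBs
        · left; simp; omega
        · left; exact ENNReal.natCast_ne_top _)
    have hEbad := hEB.trans hBsub
    have hS : ∀ x, ENNReal.ofReal (sr x) = ∑ k ∈ Finset.Icc (-(N : ℤ)) (N : ℤ),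
      ENNReal.ofReal (w ((U ^ k) x) ^ (-(1 : ℝ) / (p - 1))) := fun x =>
        ENNReal.ofReal_sum_of_nonneg fun k _ => hσ0 _
    have hV : ∀ x, ENNReal.ofReal (vr x) = ∑ k ∈ Finset.Icc (-(N : ℤ)) (N : ℤ),
      ENNReal.ofReal (w ((U ^ k) x)) := fun x =>
        ENNReal.ofReal_sum_of_nonneg fun k _ => hw _
    have hfin : ∫⁻ x in E, ENNReal.ofReal (sr x) ∂μ ≠ ∞ := by
      refine ne_top_of_le_ne_top (b := ∫⁻ x in E, ENNReal.ofReal (L:ℝ) ∂μ) ?_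
        (setLIntegral_mono measurable_const fun x hx => ENNReal.ofReal_le_ofReal (hEbad hx).2)
      rw [setLIntegral_const]
      exact ENNReal.mul_ne_top ENNReal.ofReal_ne_top (measure_ne_top _ _)
    have h1 := est U hU hUsymm w hw hwm p hp C hbound N hN E hEm hdis (fun x => ENNReal.ofReal (sr x))
      (funext hS) (fun x => ENNReal.ofReal (vr x)) (funext hV) hfin
    have hpt : ∀ x ∈ E, 0 < sr x ∧ (c + 1) * sr x ≤ (sr x / (4 * N + 1)) ^ p * vr x := by
      intro x hx
      have hb := (hEbad hx).1
      have hpos : 0 < sr x := by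
        rcases (hsr0 x).eq_or_lt with h | h
        · rw [← h, zero_div, Real.zero_rpow hp1.ne', mul_zero] at hb
          exact absurd hb (not_lt.mpr (by positivity))
        · exact h
      refine ⟨hpos, ?_⟩
      have hn : (0:ℝ) < 2 * N + 1 := by positivity
      have e1 : (sr x / (2 * (2 * N + 1))) ^ p ≤ (sr x / (4 * N + 1)) ^ p := by
        apply Real.rpow_le_rpow (by positivity) _ hp0.le
        apply div_le_div_of_nonneg_left hpos.le (by positivity) (by linarith)
      refine le_trans ?_ (mul_le_mul_of_nonneg_right e1 (hvr0 x))
      have e2 : (sr x / (2 * (2 * N + 1))) ^ p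
          = (sr x / (2 * N + 1)) ^ (p - 1) * (sr x / (2 * N + 1)) / 2 ^ p := by
        rw [show sr x / (2 * (2 * N + 1)) = (sr x / (2 * N + 1)) / 2 by field_simp,
          Real.div_rpow (by positivity) (by norm_num)]
        congr 1
        nth_rewrite 3 [← Real.rpow_one (sr x / (2 * N + 1))]
        rw [← Real.rpow_add (by positivity)]
        congr 1; ring
      have h2p : (0:ℝ) < 2 ^ p := by positivity
      rw [e2]
      calc (c + 1) * sr x = (2 ^ p * (c + 1)) * sr x / 2 ^ p := by field_simp
        _ ≤ ((vr x / (2 * N + 1)) * (sr x / (2 * N + 1)) ^ (p - 1)) * sr x / 2 ^ p := by gcongr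
        _ = _ := by ring
    have h2 : ENNReal.ofReal (c + 1) * ∫⁻ x in E, ENNReal.ofReal (sr x) ∂μ
        ≤ ENNReal.ofReal c * ∫⁻ x in E, ENNReal.ofReal (sr x) ∂μ := by
      rw [hCp] at h1
      refine le_trans ?_ h1
      rw [← lintegral_const_mul _ hsrm.ennreal_ofReal]
      refine setLIntegral_mono ?_ fun x hx => ?_
      · exact ((hsrm.ennreal_ofReal.div_const _).pow_const _).mul hvrm.ennreal_ofReal
      · have h3 := ENNReal.ofReal_le_ofReal (hpt x hx).2
        rw [ENNReal.ofReal_mul (by positivity), ENNReal.ofReal_mul (Real.rpow_nonneg (div_nonneg (hsr0 x) (by positivity)) _),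
          ← ENNReal.ofReal_rpow_of_nonneg (div_nonneg (hsr0 x) (by positivity)) hp0.le,
          ENNReal.ofReal_div_of_pos (by positivity)] at h3
        convert h3 using 4
        rw [← ENNReal.ofReal_natCast]; push_cast; rfl
    have h3 : ∫⁻ x in E, ENNReal.ofReal (sr x) ∂μ = 0 := by
      rw [ENNReal.ofReal_add hc0 zero_le_one, add_mul, ENNReal.ofReal_one, one_mul] at h2
      by_contra hne
      have := ENNReal.lt_add_right (ENNReal.mul_ne_top (ENNReal.ofReal_ne_top (r := c)) hfin) hne
      exact absurd h2 (not_le.mpr this)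
    rw [lintegral_eq_zero_iff hsrm.ennreal_ofReal] at h3
    rw [Filter.EventuallyEq, ae_restrict_iff' hEm] at h3
    apply hE0
    refine measure_mono_null ?_ (ae_iff.mp h3)
    intro x hx hcon
    have := hcon hx
    simp only [Pi.zero_apply, ENNReal.ofReal_eq_zero] at this
    exact absurd (hpt x hx).1 (not_lt.mpr this)
  have hall : ∀ᵐ x ∂μ, ∀ L, x ∉ bad L := ae_all_iff.mpr fun L => by
    rw [ae_iff]; simpa using hbad L
  filter_upwards [hall] with x hx _
  obtain ⟨L, hL⟩ := exists_nat_ge (sr x)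
  by_contra hcon
  exact hx L ⟨not_le.mp hcon, hL⟩

end ErgAp

/-- if `U` is an invertible ergodic measure-preserving transformation of a
probability space and the maximal ergodic operator is bounded on `L^p_w(X)` for some
`1 < p < ∞`, then `w` is an ergodic `A_p` weight. -/
theorem ergodic_ap_of_maximal_bounded
    {X : Type*} [MeasurableSpace X] (μ : Measure X) [IsProbabilityMeasure μ]
    (U : Equiv.Perm X) (hU : MeasurePreserving U μ μ)
    (hUsymm : MeasurePreserving U.symm μ μ) (hErg : Ergodic U μ)
    (w : X → ℝ) (hw : ∀ x, 0 ≤ w x) (hwInt : Integrable w μ)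
    (p : ℝ) (hp : 1 < p) (C : ℝ≥0∞) (hC : C ≠ ∞)
    (hbound : ∀ f : X → ℝ, Measurable f →
      (∫⁻ x, ENNReal.ofReal |f x| ^ p * ENNReal.ofReal (w x) ∂μ) ≠ ∞ →
      (∫⁻ x, (MErg U f x) ^ p * ENNReal.ofReal (w x) ∂μ) ^ (1 / p) ≤
        C * (∫⁻ x, ENNReal.ofReal |f x| ^ p * ENNReal.ofReal (w x) ∂μ) ^ (1 / p)) :
    ∃ C' : ℝ, ErgodicAp μ U w p C' := by
  obtain ⟨g, hgm, hg⟩ := hwInt.aestronglyMeasurable.aemeasurable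
  set w' : X → ℝ := fun x => max (g x) 0 with hw'
  have hww : w =ᵐ[μ] w' := by
    filter_upwards [hg] with x hx
    simp only [hw', ← hx, max_eq_left (hw x)]
  have hI : ∀ F : X → ℝ≥0∞, ∫⁻ x, F x * ENNReal.ofReal (w' x) ∂μ
      = ∫⁻ x, F x * ENNReal.ofReal (w x) ∂μ := by
    intro F
    refine lintegral_congr_ae ?_
    filter_upwards [hww] with x hx
    rw [hx]
  obtain ⟨C', hC'⟩ := ErgAp.meas (μ := μ) U hErg hU hUsymm w' (fun x => le_max_right _ _)
    (hgm.max measurable_const) p hp C hC (by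
      intro f hf hfin
      rw [hI] at hfin
      rw [hI, hI]
      exact hbound f hf hfin)
  refine ⟨C', ?_⟩
  have hall : ∀ᵐ x ∂μ, ∀ k : ℤ, w ((U ^ k) x) = w' ((U ^ k) x) := ae_all_iff.mpr fun k =>
    (ErgAp.mp U hU hUsymm k).quasiMeasurePreserving.ae hww
  filter_upwards [hC', hall] with x hx hk N hN
  simp only [hk]
  exact hx N hN
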